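/- Frequency-splitting L^∞ bound (Lemma A.2): let s > 0. There exists a constant C > 0, depending only on s, such that for every f ∈ H¹(ℝ²) ∩ Ḣ^{1+s}(ℝ²) and every positive integer N, ‖f‖_{L^∞(ℝ²)} ≤ C ( ‖f‖_{L²} + √N · ‖f‖_{Ḣ¹} + 2^{−Ns} · ‖f‖_{Ḣ^{1+s}} ). -/

import Mathlib

open MeasureTheory
open scoped ENNReal FourierTransform

noncomputable section

/-- Two-dimensional space `ℝ²`. -/
abbrev Spc : Type := EuclideanSpace ℝ (Fin 2)

/-- Squared homogeneous Sobolev norm `‖f‖_{Ḣ^σ}² = ∫_{ℝ²} |ξ|^{2σ} |f̂(ξ)|² dξ`. -/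
def hSob (σ : ℝ) (f : Spc → ℝ) : ℝ≥0∞ :=
  ∫⁻ ξ : Spc, ENNReal.ofReal (‖ξ‖ ^ (2 * σ)) *
    (‖𝓕 (fun x => (f x : ℂ)) ξ‖₊ : ℝ≥0∞) ^ 2

/-- The homogeneous Sobolev norm `‖f‖_{Ḣ^σ}`. -/
def hNorm (σ : ℝ) (f : Spc → ℝ) : ℝ := Real.sqrt (hSob σ f).toReal

/-- The `L²(ℝ²)` norm. -/
def l2Norm (f : Spc → ℝ) : ℝ :=
  Real.sqrt (∫⁻ x : Spc, (‖f x‖₊ : ℝ≥0∞) ^ 2).toReal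


open Metric

lemma aux_cs (A : Set Spc) (G W : Spc → ℝ≥0∞) (hG : Measurable G) (hW : Measurable W)
    (hA : MeasurableSet A)
    (h0 : ∀ ξ ∈ A, W ξ ≠ 0) (ht : ∀ ξ ∈ A, W ξ ≠ ⊤) :
    ∫⁻ ξ in A, G ξ ≤ (∫⁻ ξ in A, (W ξ)⁻¹) ^ (1/2 : ℝ) * (∫⁻ ξ, W ξ * G ξ ^ 2) ^ (1/2 : ℝ) := by
  have h1 : ∫⁻ ξ in A, G ξ
      = ∫⁻ ξ in A, ((fun ξ => (W ξ)⁻¹ ^ (1/2:ℝ)) * (fun ξ => W ξ ^ (1/2:ℝ) * G ξ)) ξ := by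
    apply setLIntegral_congr_fun hA
    intro ξ hξ
    simp only [Pi.mul_apply]
    rw [← mul_assoc, ← ENNReal.mul_rpow_of_nonneg _ _ (by norm_num),
      ENNReal.inv_mul_cancel (h0 ξ hξ) (ht ξ hξ)]
    simp
  rw [h1]
  refine (ENNReal.lintegral_mul_le_Lp_mul_Lq _ Real.HolderConjugate.two_two
    (by fun_prop) (by fun_prop)).trans ?_
  have e1 : ∀ a : ℝ≥0∞, (a ^ (1/2:ℝ)) ^ (2:ℝ) = a := by
    intro a
    rw [← ENNReal.rpow_mul]; norm_num
  refine mul_le_mul' (ENNReal.rpow_le_rpow (lintegral_mono fun ξ => (e1 _).le) (by norm_num))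
    (ENNReal.rpow_le_rpow ?_ (by norm_num))
  · refine (lintegral_mono fun ξ => ?_).trans (setLIntegral_le_lintegral A _)
    rw [ENNReal.mul_rpow_of_nonneg _ _ (by norm_num), e1]
    simp

lemma aux_meas (a b : ℝ) : MeasurableSet {ξ : Spc | a ≤ ‖ξ‖ ∧ ‖ξ‖ < b} := by
  have h1 : MeasurableSet {ξ : Spc | a ≤ ‖ξ‖} := measurableSet_le measurable_const measurable_norm
  have h2 : MeasurableSet {ξ : Spc | ‖ξ‖ < b} := measurableSet_lt measurable_norm measurable_const
  exact h1.inter h2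

/-- Dyadic annulus. -/
def ann (k : ℕ) : Set Spc := {ξ | (2:ℝ)^k ≤ ‖ξ‖ ∧ ‖ξ‖ < 2^(k+1)}

lemma aux_ann (σ : ℝ) (hσ : 0 ≤ σ) (k : ℕ) :
    ∫⁻ ξ in ann k, (ENNReal.ofReal (‖ξ‖ ^ (2*(1+σ))))⁻¹
      ≤ 4 * volume (ball (0:Spc) 1) * ENNReal.ofReal ((2:ℝ)^(-2*σ)) ^ k := by
  have hm : MeasurableSet (ann k) := aux_meas _ _
  have hp : (0:ℝ) < ((2:ℝ)^k) ^ (2*(1+σ)) := by positivity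
  calc _ ≤ ∫⁻ ξ in ann k, (ENNReal.ofReal (((2:ℝ)^k) ^ (2*(1+σ))))⁻¹ := by
        apply setLIntegral_mono' hm
        intro ξ hξ
        apply ENNReal.inv_le_inv.2
        apply ENNReal.ofReal_le_ofReal
        exact Real.rpow_le_rpow (by positivity) hξ.1 (by positivity)
    _ = (ENNReal.ofReal (((2:ℝ)^k) ^ (2*(1+σ))))⁻¹ * volume (ann k) := by simp
    _ ≤ (ENNReal.ofReal (((2:ℝ)^k) ^ (2*(1+σ))))⁻¹ * volume (ball (0:Spc) (2^(k+1))) := by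
        gcongr
        intro ξ hξ
        simpa using hξ.2
    _ = _ := by
        rw [Measure.addHaar_ball_of_pos _ _ (by positivity), ← ENNReal.ofReal_inv_of_pos hp,
          ← mul_assoc, ← ENNReal.ofReal_mul (by positivity), mul_right_comm,
          ← ENNReal.ofReal_pow (by positivity)]
        congr 1
        rw [show (4:ℝ≥0∞) = ENNReal.ofReal 4 by simp, ← ENNReal.ofReal_mul (by positivity)]
        congr 1
        have e2 : ((2:ℝ)^k) ^ (2*(1+σ)) = (2^k)^2 * ((2:ℝ)^k)^(2*σ) := by
          rw [mul_add, Real.rpow_add (by positivity)]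
          norm_num
        have e3 : ((2:ℝ)^(-2*σ))^k = (((2:ℝ)^k)^(2*σ))⁻¹ := by
          rw [← Real.rpow_natCast, ← Real.rpow_natCast, ← Real.rpow_mul (by norm_num),
            ← Real.rpow_mul (by norm_num), ← Real.rpow_neg (by norm_num)]
          congr 1; ring
        rw [e2, e3]
        simp only [finrank_euclideanSpace, Fintype.card_fin]
        have : (0:ℝ) < ((2:ℝ)^k)^(2*σ) := by positivity
        field_simp
        ring

lemma aux_mid (N : ℕ) :
    ∫⁻ ξ in {ξ : Spc | 1 ≤ ‖ξ‖ ∧ ‖ξ‖ < 2^N}, (ENNReal.ofReal (‖ξ‖ ^ (2*(1:ℝ))))⁻¹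
      ≤ 4 * volume (ball (0:Spc) 1) * N := by
  have hsub : {ξ : Spc | 1 ≤ ‖ξ‖ ∧ ‖ξ‖ < 2^N} ⊆ ⋃ k : Fin N, ann k := by
    rintro ξ ⟨h1, h2⟩
    obtain ⟨n, hn1, hn2⟩ := exists_nat_pow_near h1 (one_lt_two (α := ℝ))
    refine Set.mem_iUnion.2 ⟨⟨n, ?_⟩, hn1, hn2⟩
    exact (pow_lt_pow_iff_right₀ (one_lt_two (α := ℝ))).1 (hn1.trans_lt h2)
  refine (lintegral_mono_set hsub).trans ?_
  refine (lintegral_iUnion_le _ _).trans ?_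
  refine (ENNReal.tsum_le_tsum fun k => (?_ : _ ≤ 4 * volume (ball (0:Spc) 1))).trans ?_
  · have := aux_ann 0 le_rfl k
    simpa using this
  · simp [mul_comm]

lemma aux_out (s : ℝ) (hs : 0 < s) (N : ℕ) :
    ∫⁻ ξ in {ξ : Spc | 2^N ≤ ‖ξ‖}, (ENNReal.ofReal (‖ξ‖ ^ (2*(1+s))))⁻¹
      ≤ 4 * volume (ball (0:Spc) 1) * (1 - ENNReal.ofReal ((2:ℝ)^(-2*s)))⁻¹
        * ENNReal.ofReal ((2:ℝ)^(-2*s)) ^ N := by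
  have hsub : {ξ : Spc | 2^N ≤ ‖ξ‖} ⊆ ⋃ k, ann (N+k) := by
    intro ξ h2
    simp only [Set.mem_ofPred_eq] at h2
    obtain ⟨n, hn1, hn2⟩ := exists_nat_pow_near
      ((one_le_pow₀ (one_le_two (α := ℝ))).trans h2) (one_lt_two (α := ℝ))
    have : N < n + 1 := (pow_lt_pow_iff_right₀ (one_lt_two (α := ℝ))).1 (h2.trans_lt hn2)
    obtain ⟨k, rfl⟩ := Nat.exists_eq_add_of_le (Nat.lt_succ_iff.1 this)
    exact Set.mem_iUnion.2 ⟨k, hn1, hn2⟩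
  refine (lintegral_mono_set hsub).trans ?_
  refine (lintegral_iUnion_le _ _).trans ?_
  refine (ENNReal.tsum_le_tsum fun k => aux_ann s hs.le (N+k)).trans ?_
  simp only [pow_add]
  rw [ENNReal.tsum_mul_left, ENNReal.tsum_mul_left, ENNReal.tsum_geometric]
  apply le_of_eq
  ring

lemma aux_fin (F : SchwartzMap Spc ℂ) (σ : ℝ) (hσ : 0 ≤ σ) :
    ∫⁻ ξ : Spc, ENNReal.ofReal (‖ξ‖ ^ (2 * σ)) * (‖F ξ‖₊ : ℝ≥0∞) ^ 2 ≠ ⊤ := by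
  obtain ⟨k, hk⟩ := exists_nat_ge (2*σ)
  obtain ⟨M, hM0, hM⟩ := F.decay 0 0
  have hM' : ∀ ξ, ‖F ξ‖ ≤ M := by simpa using hM
  have hi : Integrable (fun ξ : Spc => M * (‖F ξ‖ + ‖ξ‖^k * ‖F ξ‖)) :=
    (F.integrable.norm.add (F.integrable_pow_mul volume k)).const_mul M
  have hlt := hi.lintegral_lt_top
  refine ne_top_of_le_ne_top hlt.ne (lintegral_mono fun ξ => ?_)
  have e : ((‖F ξ‖₊ : ℝ≥0∞)) = ENNReal.ofReal ‖F ξ‖ := (ofReal_norm (F ξ)).symm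
  rw [e, ← ENNReal.ofReal_pow (norm_nonneg _), ← ENNReal.ofReal_mul (by positivity)]
  apply ENNReal.ofReal_le_ofReal
  have h1 : ‖ξ‖^(2*σ) ≤ 1 + ‖ξ‖^k := by
    rcases le_total ‖ξ‖ 1 with h | h
    · have := Real.rpow_le_one (norm_nonneg ξ) h (by positivity : 0 ≤ 2*σ)
      have : 0 ≤ ‖ξ‖^k := by positivity
      linarith
    · have := Real.rpow_le_rpow_of_exponent_le h hk
      rw [Real.rpow_natCast] at this
      linarith
  calc ‖ξ‖^(2*σ) * ‖F ξ‖^2 ≤ (1 + ‖ξ‖^k) * (M * ‖F ξ‖) := by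
        rw [pow_two]
        gcongr
        exact hM' ξ
    _ = _ := by ring

lemma aux_conv (a P : ℝ≥0∞) (α : ℝ) (ha : a ≤ ENNReal.ofReal α) (hP : P ≠ ⊤) :
    a ^ (1/2:ℝ) * P ^ (1/2:ℝ) ≤ ENNReal.ofReal (Real.sqrt α * Real.sqrt P.toReal) := by
  rw [ENNReal.ofReal_mul (Real.sqrt_nonneg _)]
  have key : ∀ b : ℝ, ENNReal.ofReal (Real.sqrt b) = ENNReal.ofReal b ^ (1/2:ℝ) := by
    intro b
    rcases le_total 0 b with h | h
    · rw [Real.sqrt_eq_rpow, ENNReal.ofReal_rpow_of_nonneg h (by norm_num)]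
    · rw [Real.sqrt_eq_zero_of_nonpos h, ENNReal.ofReal_of_nonpos h]; simp
  rw [key, key, ENNReal.ofReal_toReal hP]
  gcongr

lemma aux_planch (F : SchwartzMap Spc ℂ) :
    ∫⁻ ξ : Spc, (‖(𝓕 F) ξ‖₊ : ℝ≥0∞) ^ 2 = ∫⁻ ξ : Spc, (‖F ξ‖₊ : ℝ≥0∞) ^ 2 := by
  have key : ∀ H : SchwartzMap Spc ℂ, ∫⁻ ξ : Spc, (‖H ξ‖₊ : ℝ≥0∞) ^ 2
      = ENNReal.ofReal (∫ ξ, ‖H ξ‖^2) := by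
    intro H
    rw [ofReal_integral_eq_lintegral_ofReal]
    · apply lintegral_congr
      intro ξ
      rw [ENNReal.ofReal_pow (norm_nonneg _), ofReal_norm]
      rfl
    · exact (H.memLp 2 volume).integrable_norm_pow (by norm_num)
    · exact Filter.Eventually.of_forall fun ξ => by positivity
  rw [key, key, SchwartzMap.integral_norm_sq_fourier]

lemma aux_inv (F : SchwartzMap Spc ℂ) (x : Spc) :
    ENNReal.ofReal ‖F x‖ ≤ ∫⁻ ξ : Spc, (‖(𝓕 F) ξ‖₊ : ℝ≥0∞) := by
  have h : F x = (𝓕⁻ (𝓕 F)) x := by rw [FourierTransform.fourierInv_fourier_eq]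
  rw [h, SchwartzMap.fourierInv_coe, Real.fourierInv_eq, ofReal_norm]
  refine (enorm_integral_le_lintegral_enorm _).trans (lintegral_mono fun ξ => ?_)
  apply le_of_eq
  rw [← ofReal_norm, Circle.norm_smul, ofReal_norm]
  rfl

/-- **Frequency-splitting `L^∞` bound** (Lemma A.2 of the paper): for `s > 0`
there is a `C > 0`, depending only on `s`, such that every
`f ∈ H¹(ℝ²) ∩ Ḣ^{1+s}(ℝ²)` (taken Schwartz here) satisfies, for every integer
`N ≥ 1`,
`‖f‖_{L^∞} ≤ C (‖f‖_{L²} + √N ‖f‖_{Ḣ¹} + 2^{−Ns} ‖f‖_{Ḣ^{1+s}})`. -/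
theorem frequency_splitting_Linf_bound (s : ℝ) (hs : 0 < s) :
    ∃ C > (0:ℝ), ∀ f : SchwartzMap Spc ℝ, ∀ N : ℕ, 1 ≤ N → ∀ x : Spc,
      |f x| ≤ C * (l2Norm (fun y => f y)
        + Real.sqrt N * hNorm 1 (fun y => f y)
        + (2:ℝ) ^ (-(N:ℝ) * s) * hNorm (1 + s) (fun y => f y)) := by
  obtain ⟨v, hv⟩ : ∃ v : ℝ, v = (volume (ball (0:Spc) 1)).toReal := ⟨_, rfl⟩
  have hvn : 0 ≤ v := hv ▸ ENNReal.toReal_nonneg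
  have hV : volume (ball (0:Spc) 1) = ENNReal.ofReal v := by
    rw [hv, ENNReal.ofReal_toReal measure_ball_lt_top.ne]
  set q : ℝ := (2:ℝ)^(-2*s) with hq
  have hq0 : 0 < q := by positivity
  have hq1 : q < 1 := Real.rpow_lt_one_of_one_lt_of_neg (by norm_num) (by linarith)
  set C : ℝ := 1 + Real.sqrt v + Real.sqrt (4*v) + Real.sqrt (4*v*(1-q)⁻¹) with hC
  have n1 := Real.sqrt_nonneg v
  have n2 := Real.sqrt_nonneg (4*v)
  have n3 := Real.sqrt_nonneg (4*v*(1-q)⁻¹)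
  refine ⟨C, by positivity, fun f N hN x => ?_⟩
  let F : SchwartzMap Spc ℂ := SchwartzMap.postcompCLM Complex.ofRealCLM f
  have hF : ∀ y, F y = (f y : ℂ) := fun y => rfl
  have hFF : 𝓕 (fun y => ((f y : ℝ) : ℂ)) = 𝓕 F := rfl
  set G : Spc → ℝ≥0∞ := fun ξ => (‖(𝓕 F) ξ‖₊ : ℝ≥0∞) with hG
  have hGm : Measurable G := by
    have := (𝓕 F).continuous
    fun_prop
  have hS : ∀ σ : ℝ, hSob σ (fun y => f y)
      = ∫⁻ ξ : Spc, ENNReal.ofReal (‖ξ‖ ^ (2 * σ)) * G ξ ^ 2 := fun σ => rfl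
  have hSf : ∀ σ : ℝ, 0 ≤ σ → hSob σ (fun y => f y) ≠ ⊤ := fun σ hσ => aux_fin (𝓕 F) σ hσ
  have hL : ∫⁻ x : Spc, (‖f x‖₊ : ℝ≥0∞) ^ 2 = ∫⁻ ξ : Spc, 1 * G ξ ^ 2 := by
    simp only [one_mul, hG]
    rw [aux_planch]
    apply lintegral_congr
    intro y
    rw [hF]
    congr 2
    ext
    simp
  have hLf : ∫⁻ ξ : Spc, 1 * G ξ ^ 2 ≠ ⊤ := by
    have := aux_fin (𝓕 F) 0 le_rfl
    simpa using this
  have hWm : ∀ σ : ℝ, Measurable (fun ξ : Spc => ENNReal.ofReal (‖ξ‖ ^ (2 * σ))) := by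
    intro σ; fun_prop
  have mA : MeasurableSet (ball (0:Spc) 1) := measurableSet_ball
  have mB : MeasurableSet {ξ : Spc | 1 ≤ ‖ξ‖ ∧ ‖ξ‖ < 2^N} := aux_meas _ _
  have mC : MeasurableSet {ξ : Spc | 2^N ≤ ‖ξ‖} := measurableSet_le (by fun_prop) (by fun_prop)
  have bA : ∫⁻ ξ in ball (0:Spc) 1, G ξ ≤ ENNReal.ofReal
      (Real.sqrt v * l2Norm (fun y => f y)) := by
    refine (aux_cs _ G (fun _ => 1) hGm measurable_const mA (by simp) (by simp)).trans ?_
    rw [l2Norm, hL]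
    refine aux_conv _ _ _ ?_ hLf
    simp [hV]
  have bB : ∫⁻ ξ in {ξ : Spc | 1 ≤ ‖ξ‖ ∧ ‖ξ‖ < 2^N}, G ξ ≤ ENNReal.ofReal
      (Real.sqrt (4*v*N) * hNorm 1 (fun y => f y)) := by
    refine (aux_cs _ G _ hGm (hWm 1) mB ?_ (by simp)).trans ?_
    · intro ξ hξ
      have : 0 < ‖ξ‖ := zero_lt_one.trans_le hξ.1
      have : 0 < ‖ξ‖ ^ (2*(1:ℝ)) := by positivity
      exact (ENNReal.ofReal_pos.2 this).ne'
    · rw [← hS]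
      refine aux_conv _ _ _ ?_ (hSf 1 (by norm_num))
      refine (aux_mid N).trans (le_of_eq ?_)
      rw [hV, ENNReal.ofReal_mul (by positivity), ENNReal.ofReal_mul (by positivity)]
      simp
  have bC : ∫⁻ ξ in {ξ : Spc | 2^N ≤ ‖ξ‖}, G ξ ≤ ENNReal.ofReal
      (Real.sqrt (4*v*(1-q)⁻¹*q^N) * hNorm (1+s) (fun y => f y)) := by
    refine (aux_cs _ G _ hGm (hWm (1+s)) mC ?_ (by simp)).trans ?_
    · intro ξ hξ
      have : 0 < ‖ξ‖ := lt_of_lt_of_le (by positivity) hξ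
      have : 0 < ‖ξ‖ ^ (2*(1+s)) := by positivity
      exact (ENNReal.ofReal_pos.2 this).ne'
    · rw [← hS]
      refine aux_conv _ _ _ ?_ (hSf (1+s) (by linarith))
      refine (aux_out s hs N).trans (le_of_eq ?_)
      have : 0 < 1 - q := by linarith
      rw [hV, ENNReal.ofReal_mul (by positivity), ENNReal.ofReal_mul (by positivity),
        ENNReal.ofReal_mul (by positivity), ENNReal.ofReal_inv_of_pos this,
        ENNReal.ofReal_sub _ hq0.le, ENNReal.ofReal_pow hq0.le, hq]
      simp
  have l1 : 0 ≤ l2Norm (fun y => f y) := Real.sqrt_nonneg _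
  have l2 : 0 ≤ hNorm 1 (fun y => f y) := Real.sqrt_nonneg _
  have l3 : 0 ≤ hNorm (1+s) (fun y => f y) := Real.sqrt_nonneg _
  have hcov : (Set.univ : Set Spc) ⊆ (ball (0:Spc) 1 ∪ {ξ : Spc | 1 ≤ ‖ξ‖ ∧ ‖ξ‖ < 2^N})
      ∪ {ξ : Spc | 2^N ≤ ‖ξ‖} := by
    intro ξ _
    simp only [Set.mem_union, mem_ball_zero_iff, Set.mem_ofPred_eq]
    rcases lt_or_ge ‖ξ‖ 1 with h | h
    · exact Or.inl (Or.inl h)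
    · rcases lt_or_ge ‖ξ‖ (2^N) with h' | h'
      · exact Or.inl (Or.inr ⟨h, h'⟩)
      · exact Or.inr h'
  have htot : ENNReal.ofReal |f x| ≤ ENNReal.ofReal
      (Real.sqrt v * l2Norm (fun y => f y) + Real.sqrt (4*v*N) * hNorm 1 (fun y => f y)
        + Real.sqrt (4*v*(1-q)⁻¹*q^N) * hNorm (1+s) (fun y => f y)) := by
    rw [ENNReal.ofReal_add (by positivity) (by positivity),
      ENNReal.ofReal_add (by positivity) (by positivity)]
    have h0 := aux_inv F x
    rw [hF, Complex.norm_real, Real.norm_eq_abs, ← setLIntegral_univ] at h0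
    refine h0.trans ((lintegral_mono_set hcov).trans ((lintegral_union_le _ _ _).trans ?_))
    exact add_le_add ((lintegral_union_le _ _ _).trans (add_le_add bA bB)) bC
  have hreal := (ENNReal.ofReal_le_ofReal_iff (by positivity)).1 htot
  refine hreal.trans ?_
  have e1 : Real.sqrt (4*v*N) = Real.sqrt (4*v) * Real.sqrt N := Real.sqrt_mul (by positivity) _
  have e2 : Real.sqrt (4*v*(1-q)⁻¹*q^N) = Real.sqrt (4*v*(1-q)⁻¹) * (2:ℝ)^(-(N:ℝ)*s) := by
    have : 0 < 1 - q := by linarith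
    rw [Real.sqrt_mul (by positivity)]
    congr 1
    rw [Real.sqrt_eq_iff_mul_self_eq (by positivity) (by positivity), hq, ← Real.rpow_natCast,
      ← Real.rpow_mul (by norm_num), ← Real.rpow_add (by norm_num)]
    congr 1; ring
  rw [e1, e2, mul_add, mul_add, ← mul_assoc, ← mul_assoc, mul_assoc C, mul_assoc C,
    mul_assoc (Real.sqrt (4*v)), mul_assoc (Real.sqrt (4*v*(1-q)⁻¹))]
  gcongr <;> linarith
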